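/- In F(3), the foliations H₁, H₃, H₅, H₇ and F₄ all degenerate onto F₁ (i.e. O(F₁) is contained in the closure of each of their orbits, which are distinct from O(F₁)), and the foliations H₂, H₄, H₆, H₈ and F₄ all degenerate onto F₂, where these foliations are given in the affine chart z = 1 by: H₁: y³dx − x³dy; H₂: x³dx − y³dy; H₃: y²(3x+y)dx − x²(x+3y)dy; H₄: y²(3x+y)dx + x²(x+3y)dy; H₅: 2y³dx + x²(3y−2x)dy; H₆: (4x³−6x²y+4y³)dx + x²(3y−2x)dy; H₇: y³dx + x(3y²−x²)dy; H₈: x(x²−3y²)dx − 4y³dy; F₁: y³dx + x³(x dy − y dx); F₂: x³dx + y³(x dy − y dx); F₄: (x³+y³)dx + x³(x dy − y dx). -/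

import Mathlib

open MvPolynomial

noncomputable section

/-- Substitution of the linear change of variables on `ℂ³` given by the matrix `M`. -/
def subst3 (M : Matrix (Fin 3) (Fin 3) ℂ) (P : MvPolynomial (Fin 3) ℂ) :
    MvPolynomial (Fin 3) ℂ :=
  aeval (fun i => ∑ j, C (M i j) * X j) P

/-- Pullback of the 1-form with coefficient vector `Ω` by the linear map of matrix `M`. -/
def pb3 (M : Matrix (Fin 3) (Fin 3) ℂ) (Ω : Fin 3 → MvPolynomial (Fin 3) ℂ) :
    Fin 3 → MvPolynomial (Fin 3) ℂ :=
  fun i => ∑ j, C (M j i) * subst3 M (Ω j)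

/-- Two foliations (given by their projective 1-forms) are linearly conjugate:
`T*Ω = c·Ω'` for some `T ∈ GL₃(ℂ)` and `c ∈ ℂ*`. -/
def LinConj3 (Ω Ω' : Fin 3 → MvPolynomial (Fin 3) ℂ) : Prop :=
  ∃ (M : Matrix (Fin 3) (Fin 3) ℂ) (c : ℂ), IsUnit M.det ∧ c ≠ 0 ∧
    pb3 M Ω = fun i => C c * Ω' i

/-- The orbit of the 1-form `Ω` under pullback by `GL₃(ℂ)` and nonzero rescaling
(the cone over the `PGL₃(ℂ)`-orbit of the corresponding foliation). -/
def OrbitOf (Ω : Fin 3 → MvPolynomial (Fin 3) ℂ) :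
    Set (Fin 3 → MvPolynomial (Fin 3) ℂ) :=
  {Ω' | LinConj3 Ω Ω'}

/-- `Ω` defines a degree-`d` foliation of `ℙ²(ℂ)`: it is a nonzero 1-form with
homogeneous coefficients of degree `d + 1` annihilating the radial vector field and
with no common factor. -/
def IsFolDeg (d : ℕ) (Ω : Fin 3 → MvPolynomial (Fin 3) ℂ) : Prop :=
  Ω ≠ 0 ∧ (∀ i, (Ω i).IsHomogeneous (d + 1)) ∧
    X 0 * Ω 0 + X 1 * Ω 1 + X 2 * Ω 2 = 0 ∧
    ∀ h : MvPolynomial (Fin 3) ℂ, (∀ i, h ∣ Ω i) → IsUnit h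

/-- The coefficient vector of a triple of polynomials. -/
def coeffs (Ω : Fin 3 → MvPolynomial (Fin 3) ℂ) : Fin 3 → (Fin 3 →₀ ℕ) → ℂ :=
  fun i m => coeff m (Ω i)

/-- Closure, inside the space `F(d)` of degree-`d` foliations with its classical
topology (read off on the coefficients), of a set of defining 1-forms. -/
def FClos (d : ℕ) (S : Set (Fin 3 → MvPolynomial (Fin 3) ℂ)) :
    Set (Fin 3 → MvPolynomial (Fin 3) ℂ) :=
  {Ω' | IsFolDeg d Ω' ∧ coeffs Ω' ∈ closure (coeffs '' S)}

/-- `√3` as a complex number. -/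
def s3 : ℂ := (Real.sqrt 3 : ℝ)

/-- Projective 1-form of `H₁ : y³dx − x³dy`. -/
def OmH1 : Fin 3 → MvPolynomial (Fin 3) ℂ :=
  ![X 2 * X 1 ^ 3, -(X 2 * X 0 ^ 3), X 0 ^ 3 * X 1 - X 0 * X 1 ^ 3]

/-- Projective 1-form of `H₂ : x³dx − y³dy`. -/
def OmH2 : Fin 3 → MvPolynomial (Fin 3) ℂ :=
  ![X 2 * X 0 ^ 3, -(X 2 * X 1 ^ 3), X 1 ^ 4 - X 0 ^ 4]

/-- Projective 1-form of `H₃ : y²(3x+y)dx − x²(x+3y)dy`. -/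
def OmH3 : Fin 3 → MvPolynomial (Fin 3) ℂ :=
  ![X 2 * (3 * X 0 * X 1 ^ 2 + X 1 ^ 3), -(X 2 * (X 0 ^ 3 + 3 * X 0 ^ 2 * X 1)),
    X 0 ^ 3 * X 1 - X 0 * X 1 ^ 3]

/-- Projective 1-form of `H₄ : y²(3x+y)dx + x²(x+3y)dy`. -/
def OmH4 : Fin 3 → MvPolynomial (Fin 3) ℂ :=
  ![X 2 * (3 * X 0 * X 1 ^ 2 + X 1 ^ 3), X 2 * (X 0 ^ 3 + 3 * X 0 ^ 2 * X 1),
    -(X 0 ^ 3 * X 1 + 6 * X 0 ^ 2 * X 1 ^ 2 + X 0 * X 1 ^ 3)]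

/-- Projective 1-form of `H₅ : 2y³dx + x²(3y−2x)dy`. -/
def OmH5 : Fin 3 → MvPolynomial (Fin 3) ℂ :=
  ![2 * X 2 * X 1 ^ 3, X 2 * (3 * X 0 ^ 2 * X 1 - 2 * X 0 ^ 3),
    -(2 * X 0 * X 1 ^ 3 + 3 * X 0 ^ 2 * X 1 ^ 2 - 2 * X 0 ^ 3 * X 1)]

/-- Projective 1-form of `H₆ : (4x³−6x²y+4y³)dx + x²(3y−2x)dy`. -/
def OmH6 : Fin 3 → MvPolynomial (Fin 3) ℂ :=
  ![X 2 * (4 * X 0 ^ 3 - 6 * X 0 ^ 2 * X 1 + 4 * X 1 ^ 3),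
    X 2 * (3 * X 0 ^ 2 * X 1 - 2 * X 0 ^ 3),
    -(4 * X 0 ^ 4 - 8 * X 0 ^ 3 * X 1 + 3 * X 0 ^ 2 * X 1 ^ 2 + 4 * X 0 * X 1 ^ 3)]

/-- Projective 1-form of `H₇ : y³dx + x(3y²−x²)dy`. -/
def OmH7 : Fin 3 → MvPolynomial (Fin 3) ℂ :=
  ![X 2 * X 1 ^ 3, X 2 * (3 * X 0 * X 1 ^ 2 - X 0 ^ 3),
    X 0 ^ 3 * X 1 - 4 * X 0 * X 1 ^ 3]

/-- Projective 1-form of `H₈ : x(x²−3y²)dx − 4y³dy`. -/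
def OmH8 : Fin 3 → MvPolynomial (Fin 3) ℂ :=
  ![X 2 * (X 0 ^ 3 - 3 * X 0 * X 1 ^ 2), -(4 * X 2 * X 1 ^ 3),
    -(X 0 ^ 4 - 3 * X 0 ^ 2 * X 1 ^ 2 - 4 * X 1 ^ 4)]

/-- Projective 1-form of `H₉ : y²((−3+i√3)x+2y)dx + x²((1+i√3)x−2i√3·y)dy`. -/
def OmH9 : Fin 3 → MvPolynomial (Fin 3) ℂ :=
  ![X 2 * (C (-3 + Complex.I * s3) * X 0 * X 1 ^ 2 + 2 * X 1 ^ 3),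
    X 2 * (C (1 + Complex.I * s3) * X 0 ^ 3 - C (2 * (Complex.I * s3)) * X 0 ^ 2 * X 1),
    -(C (1 + Complex.I * s3) * X 0 ^ 3 * X 1 + C (-3 - Complex.I * s3) * X 0 ^ 2 * X 1 ^ 2 +
      2 * X 0 * X 1 ^ 3)]

/-- Projective 1-form of
`H₁₁ : (3x³+3√3x²y+3xy²+√3y³)dx + (√3x³+3x²y+3√3xy²+3y³)dy`. -/
def OmH11 : Fin 3 → MvPolynomial (Fin 3) ℂ :=
  ![X 2 * (3 * X 0 ^ 3 + C (3 * s3) * X 0 ^ 2 * X 1 + 3 * X 0 * X 1 ^ 2 + C s3 * X 1 ^ 3),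
    X 2 * (C s3 * X 0 ^ 3 + 3 * X 0 ^ 2 * X 1 + C (3 * s3) * X 0 * X 1 ^ 2 + 3 * X 1 ^ 3),
    -(3 * X 0 ^ 4 + C (4 * s3) * X 0 ^ 3 * X 1 + 6 * X 0 ^ 2 * X 1 ^ 2 +
      C (4 * s3) * X 0 * X 1 ^ 3 + 3 * X 1 ^ 4)]

/-- Projective 1-form of `F₁ : y³dx + x³(x dy − y dx)`. -/
def OmF1 : Fin 3 → MvPolynomial (Fin 3) ℂ :=
  ![X 2 * X 1 ^ 3 - X 0 ^ 3 * X 1, X 0 ^ 4, -(X 0 * X 1 ^ 3)]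

/-- Projective 1-form of `F₂ : x³dx + y³(x dy − y dx)`. -/
def OmF2 : Fin 3 → MvPolynomial (Fin 3) ℂ :=
  ![X 2 * X 0 ^ 3 - X 1 ^ 4, X 0 * X 1 ^ 3, -(X 0 ^ 4)]

/-- Projective 1-form of the Fermat foliation `F₃ : (x³−x)dy − (y³−y)dx`. -/
def OmF3 : Fin 3 → MvPolynomial (Fin 3) ℂ :=
  ![X 1 * X 2 ^ 3 - X 1 ^ 3 * X 2, X 0 ^ 3 * X 2 - X 0 * X 2 ^ 3,
    X 0 * X 1 ^ 3 - X 0 ^ 3 * X 1]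

/-- Projective 1-form of `F₄ : (x³+y³)dx + x³(x dy − y dx)`. -/
def OmF4 : Fin 3 → MvPolynomial (Fin 3) ℂ :=
  ![X 2 * (X 0 ^ 3 + X 1 ^ 3) - X 0 ^ 3 * X 1, X 0 ^ 4, -(X 0 ^ 4 + X 0 * X 1 ^ 3)]

/-- Projective 1-form of `F₅ : y²(y dx + 2x dy) + x³(x dy − y dx)`. -/
def OmF5 : Fin 3 → MvPolynomial (Fin 3) ℂ :=
  ![X 2 * X 1 ^ 3 - X 0 ^ 3 * X 1, 2 * X 0 * X 1 ^ 2 * X 2 + X 0 ^ 4,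
    -(3 * X 0 * X 1 ^ 3)]

/-- `F` degenerates onto `F'`: `O(F')` is contained in the closure of `O(F)` in
`F(3)`, and the two orbits are distinct. -/
def Degen (Ω Ω' : Fin 3 → MvPolynomial (Fin 3) ℂ) : Prop :=
  OrbitOf Ω' ⊆ FClos 3 (OrbitOf Ω) ∧ OrbitOf Ω ≠ OrbitOf Ω'

set_option linter.unusedSimpArgs false
set_option linter.unusedVariables false
set_option linter.unreachableTactic false
set_option linter.unusedTactic false

lemma subst3_add (M) (P Q) : subst3 M (P + Q) = subst3 M P + subst3 M Q := by simp [subst3]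
lemma subst3_sub (M) (P Q) : subst3 M (P - Q) = subst3 M P - subst3 M Q := by simp [subst3]
lemma subst3_neg (M) (P) : subst3 M (-P) = -subst3 M P := by simp [subst3]
lemma subst3_mul (M) (P Q) : subst3 M (P * Q) = subst3 M P * subst3 M Q := by simp [subst3]
lemma subst3_pow (M) (P) (n : ℕ) : subst3 M (P ^ n) = subst3 M P ^ n := by simp [subst3]
lemma subst3_C (M) (c : ℂ) : subst3 M (C c) = C c := by simp [subst3, algebraMap_eq]
lemma subst3_X (M) (i) : subst3 M (X i) = ∑ j, C (M i j) * X j := by simp [subst3]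
lemma subst3_sum (M) (f : Fin 3 → MvPolynomial (Fin 3) ℂ) :
    subst3 M (∑ i, f i) = ∑ i, subst3 M (f i) := by simp [subst3]

lemma subst3_ofNat (M) (n : ℕ) [n.AtLeastTwo] :
    subst3 M ofNat(n) = ofNat(n) := map_ofNat (aeval _) n
lemma C_ofNat' (n : ℕ) [n.AtLeastTwo] :
    (C ofNat(n) : MvPolynomial (Fin 3) ℂ) = ofNat(n) := map_ofNat C n

lemma subst3_comp (M N) (P) : subst3 N (subst3 M P) = subst3 (M * N) P := by
  induction P using MvPolynomial.induction_on with
  | C a => simp only [subst3_C]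
  | add p q hp hq => simp only [subst3_add, hp, hq]
  | mul_X p i hp =>
    simp only [subst3_mul, hp, subst3_X, subst3_add, subst3_C, Matrix.mul_apply,
      Fin.sum_univ_three, map_add, map_mul]
    ring

lemma subst3_one (P) : subst3 1 P = P := by
  have : (fun i : Fin 3 => ∑ j, C ((1 : Matrix (Fin 3) (Fin 3) ℂ) i j) * X j)
      = (X : Fin 3 → MvPolynomial (Fin 3) ℂ) := by
    funext i
    simp [Matrix.one_apply, apply_ite]
  simp only [subst3, this, aeval_X_left, AlgHom.id_apply]

lemma pb3_comp (M N) (Ω) : pb3 N (pb3 M Ω) = pb3 (M * N) Ω := by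
  funext i
  simp only [pb3, subst3_add, subst3_mul, subst3_C, subst3_comp, Matrix.mul_apply,
      Fin.sum_univ_three, map_add, map_mul]
  ring

lemma pb3_one (Ω) : pb3 1 Ω = Ω := by
  funext i
  simp only [pb3, subst3_one]
  simp [Matrix.one_apply, apply_ite]

lemma pb3_smul (M) (c : ℂ) (Ω) : pb3 M (fun i => C c * Ω i) = fun i => C c * pb3 M Ω i := by
  funext i
  simp only [pb3, subst3_mul, subst3_C, Fin.sum_univ_three]
  ring

def CC (f : ℂ → MvPolynomial (Fin 3) ℂ) : Prop := ∀ m, Continuous fun t => coeff m (f t)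

lemma CC.add {f g} (hf : CC f) (hg : CC g) : CC (fun t => f t + g t) := fun m => by
  simp only [coeff_add]; exact (hf m).add (hg m)
lemma CC.sub {f g} (hf : CC f) (hg : CC g) : CC (fun t => f t - g t) := fun m => by
  simp only [coeff_sub]; exact (hf m).sub (hg m)
lemma CC.neg {f} (hf : CC f) : CC (fun t => - f t) := fun m => by
  simp only [coeff_neg]; exact (hf m).neg
lemma CC.mul {f g} (hf : CC f) (hg : CC g) : CC (fun t => f t * g t) := fun m => by
  simp only [coeff_mul]
  exact continuous_finsetSum _ fun x _ => (hf _).mul (hg _)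
lemma CC.const (p) : CC (fun _ => p) := fun m => continuous_const
lemma CC.pow {f} (hf : CC f) (n : ℕ) : CC (fun t => f t ^ n) := by
  induction n with
  | zero => simpa using CC.const 1
  | succ n ih => simpa only [pow_succ] using ih.mul hf
lemma CC.T : CC (fun t => C t) := fun m => by
  classical
  simp only [coeff_C]
  split_ifs
  · exact continuous_id
  · exact continuous_const

def Good (f : ℂ → MvPolynomial (Fin 3) ℂ) : Prop := ∀ N, CC fun t => subst3 N (f t)

lemma Good.add {f g} (hf : Good f) (hg : Good g) : Good (fun t => f t + g t) := fun m => by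
  simpa only [subst3_add] using (hf m).add (hg m)
lemma Good.sub {f g} (hf : Good f) (hg : Good g) : Good (fun t => f t - g t) := fun m => by
  simpa only [subst3_sub] using (hf m).sub (hg m)
lemma Good.neg {f} (hf : Good f) : Good (fun t => - f t) := fun m => by
  simpa only [subst3_neg] using (hf m).neg
lemma Good.mul {f g} (hf : Good f) (hg : Good g) : Good (fun t => f t * g t) := fun m => by
  simpa only [subst3_mul] using (hf m).mul (hg m)
lemma Good.pow {f} (hf : Good f) (n : ℕ) : Good (fun t => f t ^ n) := fun m => by
  simpa only [subst3_pow] using (hf m).pow n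
lemma Good.const (p) : Good (fun _ => p) := fun m => CC.const _
lemma Good.T : Good (fun t => C t) := fun m => by
  simpa only [subst3_C] using CC.T

/-- a curve `A + t B + t² C + t³ D + t⁴ E` -/
def curve (A B D E F : Fin 3 → MvPolynomial (Fin 3) ℂ) (t : ℂ) : Fin 3 → MvPolynomial (Fin 3) ℂ :=
  fun i => A i + C t * B i + C t ^ 2 * D i + C t ^ 3 * E i + C t ^ 4 * F i

lemma curve_good (A B D E F) (i) : Good (fun t => curve A B D E F t i) :=
  ((((Good.const _).add (Good.T.mul (Good.const _))).add ((Good.T.pow 2).mul (Good.const _))).add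
    ((Good.T.pow 3).mul (Good.const _))).add ((Good.T.pow 4).mul (Good.const _))

lemma fol_orbit {Ω Ω'} (h : IsFolDeg 3 Ω) (hc : LinConj3 Ω Ω') : IsFolDeg 3 Ω' := by
  obtain ⟨N, c, hN, hc, hpb⟩ := hc
  obtain ⟨h0, hh, hr, hd⟩ := h
  have hNN : N * N⁻¹ = 1 := Matrix.mul_nonsing_inv N hN
  have hNN' : N⁻¹ * N = 1 := Matrix.nonsing_inv_mul N hN
  have hCu : C c * C c⁻¹ = (1 : MvPolynomial (Fin 3) ℂ) := by
    rw [← C_mul, mul_inv_cancel₀ hc, C_1]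
  have e : ∀ i, Ω' i = C c⁻¹ * pb3 N Ω i := fun i => by
    rw [hpb]
    linear_combination (-Ω' i) * hCu
  have e2 : ∀ i, Ω i = ∑ j, C (N⁻¹ j i) * (C c * subst3 N⁻¹ (Ω' j)) := fun i => by
    have := congrFun (congrArg (pb3 N⁻¹) hpb) i
    rw [pb3_comp, hNN, pb3_one, pb3_smul] at this
    rw [this]
    simp only [pb3, Fin.sum_univ_three]
    ring
  refine ⟨?_, ?_, ?_, ?_⟩
  · rintro rfl
    apply h0
    funext i
    rw [e2]
    simp [subst3]
  · intro i
    rw [e]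
    have : ∀ j, (C c⁻¹ * (C (N j i) * subst3 N (Ω j))).IsHomogeneous (3 + 1) := fun j => by
      have h1 : (subst3 N (Ω j)).IsHomogeneous (1 * (3 + 1)) := by
        apply (hh j).aeval
        intro k
        apply IsHomogeneous.sum
        intro l _
        simpa using (isHomogeneous_C (Fin 3) (N k l)).mul (isHomogeneous_X ℂ l)
      have := (isHomogeneous_C (Fin 3) c⁻¹).mul ((isHomogeneous_C (Fin 3) (N j i)).mul h1)
      simpa using this
    simp only [pb3, Finset.mul_sum]
    exact IsHomogeneous.sum _ _ _ fun j _ => this j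
  · have := congrArg (subst3 N) hr
    simp only [subst3_add, subst3_mul, subst3_X, Fin.sum_univ_three] at this
    have z : subst3 N 0 = 0 := by simp [subst3]
    rw [z] at this
    simp only [e, pb3, Fin.sum_univ_three]
    linear_combination C c⁻¹ * this
  · intro h hdv
    have hu : IsUnit (subst3 N⁻¹ h) := by
      apply hd
      intro i
      rw [e2]
      apply Finset.dvd_sum
      intro j _
      apply Dvd.dvd.mul_left
      apply Dvd.dvd.mul_left
      obtain ⟨k, hk⟩ := hdv j
      exact ⟨subst3 N⁻¹ k, by rw [hk, subst3_mul]⟩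
    have := hu.map (aeval (fun i => ∑ j, C (N i j) * X j) :
      MvPolynomial (Fin 3) ℂ →ₐ[ℂ] MvPolynomial (Fin 3) ℂ)
    change IsUnit (subst3 N (subst3 N⁻¹ h)) at this
    rwa [subst3_comp, hNN', subst3_one] at this

lemma unit_of_dvd {h : MvPolynomial (Fin 3) ℂ} (h1 : h ∣ X 0 ^ 4) (h2 : ¬ X 0 ∣ h) : IsUnit h := by
  obtain ⟨k, hk, ha⟩ := (dvd_prime_pow (X_prime (R := ℂ) (i := (0 : Fin 3))) 4).1 h1
  rcases Nat.eq_zero_or_pos k with rfl | hp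
  · rw [pow_zero] at ha
    exact (associated_one_iff_isUnit).1 ha
  · exact absurd ((dvd_pow_self _ hp.ne').trans ha.symm.dvd) h2

lemma hX4 (i : Fin 3) : (X i ^ 4 : MvPolynomial (Fin 3) ℂ).IsHomogeneous (3 + 1) :=
  isHomogeneous_X_pow i 4
lemma hX13 (i j : Fin 3) : (X i * X j ^ 3 : MvPolynomial (Fin 3) ℂ).IsHomogeneous (3 + 1) :=
  (isHomogeneous_X ℂ i).mul (isHomogeneous_X_pow j 3)
lemma hX31 (i j : Fin 3) : (X j ^ 3 * X i : MvPolynomial (Fin 3) ℂ).IsHomogeneous (3 + 1) :=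
  (isHomogeneous_X_pow j 3).mul (isHomogeneous_X ℂ i)

lemma notdvd {i j : Fin 3} (h : i ≠ j) : ¬ (X i : MvPolynomial (Fin 3) ℂ) ∣ X j := by
  rw [X_dvd_X]; exact h

lemma fol1 : IsFolDeg 3 OmF1 := by
  refine ⟨?_, ?_, ?_, ?_⟩
  · intro h
    have := congrFun h 1
    simp [OmF1] at this
  · intro i
    fin_cases i
    · exact (hX13 2 1).sub (hX31 1 0)
    · exact hX4 0
    · exact (hX13 0 1).neg
  · simp [OmF1]; ring
  · intro h hd
    have a0 : h ∣ X 2 * X 1 ^ 3 - X 0 ^ 3 * X 1 := hd 0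
    have a1 : h ∣ X 0 ^ 4 := hd 1
    refine unit_of_dvd a1 fun hx => ?_
    have hp := X_prime (R := ℂ) (i := (0 : Fin 3))
    have h3 : (X 0 : MvPolynomial (Fin 3) ℂ) ∣ X 2 * X 1 ^ 3 := by
      have := dvd_add (hx.trans a0) (Dvd.intro (X 0 ^ 2 * X 1) rfl)
      convert this using 1
      ring
    rcases hp.dvd_or_dvd h3 with h | h
    · exact notdvd (by decide) h
    · exact notdvd (by decide) (hp.dvd_of_dvd_pow h)

lemma fol2 : IsFolDeg 3 OmF2 := by
  refine ⟨?_, ?_, ?_, ?_⟩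
  · intro h
    have := congrFun h 2
    simp [OmF2] at this
  · intro i
    fin_cases i
    · exact (hX13 2 0).sub (hX4 1)
    · exact hX13 0 1
    · exact (hX4 0).neg
  · simp [OmF2]; ring
  · intro h hd
    have a0 : h ∣ X 2 * X 0 ^ 3 - X 1 ^ 4 := hd 0
    have a1 : h ∣ X 0 ^ 4 := (dvd_neg).1 (hd 2)
    refine unit_of_dvd a1 fun hx => ?_
    have hp := X_prime (R := ℂ) (i := (0 : Fin 3))
    have h3 : (X 0 : MvPolynomial (Fin 3) ℂ) ∣ X 1 ^ 4 := by
      have := dvd_sub (Dvd.intro (X 0 ^ 2 * X 2) rfl) (hx.trans a0)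
      convert this using 1
      ring
    exact notdvd (by decide) (hp.dvd_of_dvd_pow h3)

lemma degen_core {Ω Ω'} (hF : IsFolDeg 3 Ω') (M : ℂ → Matrix (Fin 3) (Fin 3) ℂ)
    (B D E F : Fin 3 → MvPolynomial (Fin 3) ℂ) (d : ℂ) (hd : d ≠ 0)
    (hdet : ∀ t, t ≠ 0 → (M t).det ≠ 0)
    (hpb : ∀ t i, pb3 (M t) Ω i = C t ^ 4 * curve (fun i => C d * Ω' i) B D E F t i) :
    OrbitOf Ω' ⊆ FClos 3 (OrbitOf Ω) := by
  intro Ω'' h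
  refine ⟨fol_orbit hF h, ?_⟩
  obtain ⟨N, c, hN, hc, hN'⟩ := h
  set P := curve (fun i => C d * Ω' i) B D E F with hP
  let R : ℂ → Fin 3 → MvPolynomial (Fin 3) ℂ := fun t i => C (c⁻¹ * d⁻¹) * pb3 N (P t) i
  have hcont : Continuous fun t => coeffs (R t) := by
    refine continuous_pi fun i => continuous_pi fun m => ?_
    have : CC fun t => R t i := by
      simp only [R, pb3, Fin.sum_univ_three]
      exact (CC.const _).mul ((((CC.const _).mul (curve_good _ _ _ _ _ 0 N)).add
        ((CC.const _).mul (curve_good _ _ _ _ _ 1 N))).add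
        ((CC.const _).mul (curve_good _ _ _ _ _ 2 N)))
    exact this m
  have hR0 : R 0 = Ω'' := by
    have : P 0 = fun i => C d * Ω' i := by
      funext i
      simp [hP, curve]
    funext i
    simp only [R, this, pb3_smul, hN']
    rw [← mul_assoc, ← mul_assoc, ← C_mul, ← C_mul]
    have : c⁻¹ * d⁻¹ * d * c = 1 := by field_simp
    rw [this, C_1, one_mul]
  have hlim : Filter.Tendsto (fun t => coeffs (R t)) (nhdsWithin 0 {0}ᶜ) (nhds (coeffs Ω'')) := by
    rw [← hR0]
    exact (hcont.tendsto 0).mono_left nhdsWithin_le_nhds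
  refine mem_closure_of_tendsto hlim ?_
  filter_upwards [self_mem_nhdsWithin] with t ht
  have ht : t ≠ 0 := ht
  refine ⟨R t, ⟨M t * N, t ^ 4 * (c * d), ?_, by positivity, ?_⟩, rfl⟩
  · rw [Matrix.det_mul]
    exact (isUnit_iff_ne_zero.2 (hdet t ht)).mul hN
  · have : pb3 (M t) Ω = fun i => C (t ^ 4) * P t i := by
      funext i
      rw [hpb, C_pow]
    rw [← pb3_comp, this, pb3_smul]
    funext i
    simp only [R]
    rw [← mul_assoc, ← C_mul]
    have : t ^ 4 * (c * d) * (c⁻¹ * d⁻¹) = t ^ 4 := by field_simp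
    rw [this]

/-! distinctness of the orbits -/

def E (Ω : Fin 3 → MvPolynomial (Fin 3) ℂ) (p v : Fin 3 → ℂ) : ℂ := ∑ i, eval p (Ω i) * v i

lemma eval_subst3 (M) (P) (p : Fin 3 → ℂ) : eval p (subst3 M P) = eval (M.mulVec p) P := by
  induction P using MvPolynomial.induction_on with
  | C a => simp [subst3_C]
  | add p q hp hq => simp only [subst3_add, hp, hq, map_add]
  | mul_X p i hp =>
    simp [subst3_mul, hp, subst3_X, Matrix.mulVec, dotProduct, Fin.sum_univ_three]

lemma E_pb (M) (Ω) (p v) : E (pb3 M Ω) p v = E Ω (M.mulVec p) (M.mulVec v) := by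
  simp only [E, pb3, Fin.sum_univ_three, map_add, map_mul, eval_C, eval_subst3]
  simp only [Matrix.mulVec, dotProduct, Fin.sum_univ_three]
  ring

lemma conj_of_eq {Ω Ω'} (h : OrbitOf Ω = OrbitOf Ω') :
    ∃ (N : Matrix (Fin 3) (Fin 3) ℂ), IsUnit N.det ∧
      ∀ p v, E Ω p v = 0 → E Ω' (N.mulVec p) (N.mulVec v) = 0 := by
  have : Ω' ∈ OrbitOf Ω := by
    rw [h]
    exact ⟨1, 1, by simp, one_ne_zero, by rw [pb3_one]; simp⟩
  obtain ⟨M, c, hM, hc, hpb⟩ := this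
  refine ⟨M⁻¹, by simpa using hM, fun p v hE => ?_⟩
  have h1 := E_pb M Ω (M⁻¹.mulVec p) (M⁻¹.mulVec v)
  rw [Matrix.mulVec_mulVec, Matrix.mulVec_mulVec, Matrix.mul_nonsing_inv M hM,
    Matrix.one_mulVec, Matrix.one_mulVec, hE, hpb] at h1
  have h2 : c * E Ω' (M⁻¹.mulVec p) (M⁻¹.mulVec v) = 0 := by
    rw [← h1]
    simp only [E, Fin.sum_univ_three, map_mul, eval_C]
    ring
  exact (mul_eq_zero.1 h2).resolve_left hc

lemma ne2 {Ω} (a b : ℂ) (hab : a ≠ 0 ∨ b ≠ 0) (h1 : ∀ v, E Ω ![0, 0, 1] v = 0)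
    (h2 : ∀ v, E Ω ![a, b, 0] v = 0) : OrbitOf Ω ≠ OrbitOf OmF2 := by
  intro h
  obtain ⟨N, hN, hE⟩ := conj_of_eq h
  have key : ∀ p, (∀ v, E Ω p v = 0) → N.mulVec p 0 = 0 ∧ N.mulVec p 1 = 0 := by
    intro p hp
    have hv : ∀ v, E OmF2 (N.mulVec p) v = 0 := fun v => by
      have := hE p (N⁻¹.mulVec v) (hp _)
      rwa [Matrix.mulVec_mulVec, Matrix.mul_nonsing_inv N hN, Matrix.one_mulVec] at this
    have a0 := hv ![1, 0, 0]
    have a2 := hv ![0, 0, 1]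
    simp [E, OmF2, Fin.sum_univ_three] at a0 a2
    refine ⟨a2, ?_⟩
    rw [a2] at a0
    simpa using a0
  have k1 := key _ h1
  have k2 := key _ h2
  simp [Matrix.mulVec, dotProduct, Fin.sum_univ_three] at k1 k2
  rw [Matrix.det_fin_three, isUnit_iff_ne_zero] at hN
  apply hN
  rw [k1.1, k1.2]
  obtain ⟨k2, k3⟩ := k2
  rcases hab with ha | ha
  · apply mul_left_cancel₀ ha
    linear_combination N 2 2 * (N 1 1 * k2 - N 0 1 * k3)
  · apply mul_left_cancel₀ ha
    linear_combination N 2 2 * (- N 1 0 * k2 + N 0 0 * k3)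

/-- the line spanned by `p` and `q` is invariant -/
def InvL (Ω : Fin 3 → MvPolynomial (Fin 3) ℂ) (p q : Fin 3 → ℂ) : Prop :=
  ∀ s t u w : ℂ, E Ω (s • p + t • q) (u • p + w • q) = 0

lemma inv1 {p q : Fin 3 → ℂ} (h : InvL OmF1 p q) (hi : ∀ s t : ℂ, s • p + t • q = 0 → s = 0 ∧ t = 0) :
    (p 0 = 0 ∧ q 0 = 0) ∨ (p 1 = 0 ∧ q 1 = 0) := by
  have h' : ∀ s t : ℂ, (s * p 0 + t * q 0) ^ 3 * (p 0 * q 1 - p 1 * q 0)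
      = (s * p 1 + t * q 1) ^ 3 * (p 0 * q 2 - p 2 * q 0) := by
    intro s t
    by_cases hs : s = 0
    · by_cases ht : t = 0
      · simp [hs, ht]
      · have := h s t (-1) 0
        simp [E, OmF1, Fin.sum_univ_three] at this
        apply mul_left_cancel₀ ht
        linear_combination this
    · have := h s t 0 1
      simp [E, OmF1, Fin.sum_univ_three] at this
      apply mul_left_cancel₀ hs
      linear_combination this
  have hA : p 0 * q 1 - p 1 * q 0 = 0 := by
    have := h' (q 1) (- p 1)
    have h4 : (p 0 * q 1 - p 1 * q 0) ^ 4 = 0 := by linear_combination this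
    exact pow_eq_zero_iff (by norm_num) |>.1 h4
  by_cases hB : p 0 * q 2 - p 2 * q 0 = 0
  · left
    have := hi (- q 0) (p 0) (by
      funext i
      fin_cases i
      · simp; ring
      · simp; linear_combination hA
      · simp; linear_combination hB)
    exact ⟨this.2, by simpa using this.1⟩
  · right
    have a := h' 1 0
    have b := h' 0 1
    rw [hA] at a b
    simp [hB] at a b
    exact ⟨a, b⟩

lemma ne1 {Ω} (d e f : Fin 3 → ℂ) (hd : d 2 = 0) (he : e 2 = 0) (hf : f 2 = 0)
    (h1 : d 0 * e 1 - d 1 * e 0 ≠ 0) (h2 : d 0 * f 1 - d 1 * f 0 ≠ 0)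
    (h3 : e 0 * f 1 - e 1 * f 0 ≠ 0)
    (id : InvL Ω ![0, 0, 1] d) (ie : InvL Ω ![0, 0, 1] e) (jf : InvL Ω ![0, 0, 1] f) :
    OrbitOf Ω ≠ OrbitOf OmF1 := by
  intro h
  obtain ⟨N, hN, hE⟩ := conj_of_eq h
  have key : ∀ g : Fin 3 → ℂ, g 2 = 0 → (g 0 ≠ 0 ∨ g 1 ≠ 0) → InvL Ω ![0, 0, 1] g →
      ∃ k : Fin 3, (k = 0 ∨ k = 1) ∧ N k 2 = 0 ∧ N k 0 * g 0 + N k 1 * g 1 = 0 := by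
    intro g hg hg' hi
    have := inv1 (p := N.mulVec ![0, 0, 1]) (q := N.mulVec g) (by
      intro s t u w
      have := hE _ _ (hi s t u w)
      simpa only [Matrix.mulVec_add, Matrix.mulVec_smul] using this) (by
      intro s t hst
      rw [← Matrix.mulVec_smul, ← Matrix.mulVec_smul, ← Matrix.mulVec_add] at hst
      have h0 := congrArg (N⁻¹.mulVec) hst
      rw [Matrix.mulVec_mulVec, Matrix.nonsing_inv_mul N hN, Matrix.one_mulVec,
        Matrix.mulVec_zero] at h0
      have c0 := congrFun h0 0
      have c1 := congrFun h0 1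
      have c2 := congrFun h0 2
      simp [hg] at c0 c1 c2
      refine ⟨c2, ?_⟩
      rcases hg' with h | h
      · exact c0.resolve_right h
      · exact c1.resolve_right h)
    simp [Matrix.mulVec, dotProduct, Fin.sum_univ_three, hg] at this
    rcases this with h | h
    · exact ⟨0, by simp, h⟩
    · exact ⟨1, by simp, h⟩
  have fin : ∀ (k : Fin 3) (g g' : Fin 3 → ℂ), g 0 * g' 1 - g 1 * g' 0 ≠ 0 → N k 2 = 0 →
      N k 0 * g 0 + N k 1 * g 1 = 0 → N k 0 * g' 0 + N k 1 * g' 1 = 0 → False := by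
    intro k g g' hg a b c
    have n0 : N k 0 = 0 := by
      apply mul_left_cancel₀ hg
      linear_combination g' 1 * b - g 1 * c
    have n1 : N k 1 = 0 := by
      apply mul_left_cancel₀ hg
      linear_combination - g' 0 * b + g 0 * c
    rw [isUnit_iff_ne_zero] at hN
    apply hN
    apply Matrix.det_eq_zero_of_row_eq_zero k
    intro j
    fin_cases j
    · exact n0
    · exact n1
    · exact a
  have nz : ∀ x y z w : ℂ, x * y - z * w ≠ 0 → x ≠ 0 ∨ z ≠ 0 := by
    intro x y z w h
    by_contra! hh
    apply h
    simp [hh.1, hh.2]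
  have nz' : e 0 ≠ 0 ∨ e 1 ≠ 0 := nz _ _ _ _ h3
  have nz'' : f 0 ≠ 0 ∨ f 1 ≠ 0 := by
    by_contra! hh
    apply h3
    simp [hh.1, hh.2]
  obtain ⟨i, hi, a, b⟩ := key d hd (nz _ _ _ _ h1) id
  obtain ⟨j, hj, a', b'⟩ := key e he nz' ie
  obtain ⟨k, hk, a'', b''⟩ := key f hf nz'' jf
  rcases hi with rfl | rfl <;> rcases hj with rfl | rfl <;> rcases hk with rfl | rfl
  · exact fin _ _ _ h1 a b b'
  · exact fin _ _ _ h1 a b b'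
  · exact fin _ _ _ h2 a b b''
  · exact fin _ _ _ h3 a' b' b''
  · exact fin _ _ _ h3 a' b' b''
  · exact fin _ _ _ h2 a b b''
  · exact fin _ _ _ h1 a b b'
  · exact fin _ _ _ h1 a b b'


lemma deg1 : OrbitOf OmF1 ⊆ FClos 3 (OrbitOf OmH1) := by
  refine degen_core fol1 (fun t => !![0, 1, 0; t, 0, 0; t, 0, -t ^ 3]) ![0, 0, 0] ![0, -(X 0 ^ 3 * X 2), X 0 ^ 3 * X 1]
    ![0, 0, 0] ![0, 0, 0] (1) (by norm_num) ?_ ?_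
  · intro t ht
    simp [Matrix.det_fin_three, ht]
  · intro t i
    fin_cases i <;>
      simp [pb3, subst3_add, subst3_sub, subst3_neg, subst3_mul, subst3_pow, subst3_X,
        subst3_ofNat, C_ofNat', curve, Fin.sum_univ_three, OmH1, OmF1] <;> ring

lemma deg5 : OrbitOf OmF1 ⊆ FClos 3 (OrbitOf OmH5) := by
  refine degen_core fol1 (fun t => !![0, 1, 0; t, 0, 0; t, 0, -t ^ 3]) ![-(3 * X 0 * X 1 ^ 2 * X 2), 0, 3 * X 0 ^ 2 * X 1 ^ 2] ![0, -(2 * X 0 ^ 3 * X 2), 2 * X 0 ^ 3 * X 1]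
    ![0, 0, 0] ![0, 0, 0] (2) (by norm_num) ?_ ?_
  · intro t ht
    simp [Matrix.det_fin_three, ht]
  · intro t i
    fin_cases i <;>
      simp [pb3, subst3_add, subst3_sub, subst3_neg, subst3_mul, subst3_pow, subst3_X,
        subst3_ofNat, C_ofNat', curve, Fin.sum_univ_three, OmH5, OmF1] <;> ring

lemma deg7 : OrbitOf OmF1 ⊆ FClos 3 (OrbitOf OmH7) := by
  refine degen_core fol1 (fun t => !![0, 1, 0; t, 0, 0; t, 0, -t ^ 3]) ![0, 0, 0] ![-(3 * X 0 ^ 2 * X 1 * X 2), -(X 0 ^ 3 * X 2), 4 * X 0 ^ 3 * X 1]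
    ![0, 0, 0] ![0, 0, 0] (1) (by norm_num) ?_ ?_
  · intro t ht
    simp [Matrix.det_fin_three, ht]
  · intro t i
    fin_cases i <;>
      simp [pb3, subst3_add, subst3_sub, subst3_neg, subst3_mul, subst3_pow, subst3_X,
        subst3_ofNat, C_ofNat', curve, Fin.sum_univ_three, OmH7, OmF1] <;> ring

lemma deg3 : OrbitOf OmF1 ⊆ FClos 3 (OrbitOf OmH3) := by
  refine degen_core fol1 (fun t => !![0, 1, 0; t, -1, 0; 2 * t, 0, t ^ 3]) ![-(3 * X 0 * X 1 ^ 2 * X 2), 0, 3 * X 0 ^ 2 * X 1 ^ 2] ![0, X 0 ^ 3 * X 2, -(X 0 ^ 3 * X 1)]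
    ![0, 0, 0] ![0, 0, 0] (2) (by norm_num) ?_ ?_
  · intro t ht
    simp [Matrix.det_fin_three, ht]
  · intro t i
    fin_cases i <;>
      simp [pb3, subst3_add, subst3_sub, subst3_neg, subst3_mul, subst3_pow, subst3_X,
        subst3_ofNat, C_ofNat', curve, Fin.sum_univ_three, OmH3, OmF1] <;> ring

lemma deg41 : OrbitOf OmF1 ⊆ FClos 3 (OrbitOf OmF4) := by
  refine degen_core fol1 (fun t => !![t, 0, 0; 0, 1, 0; 0, 0, t ^ 3]) ![0, 0, 0] ![0, 0, 0]
    ![X 0 ^ 3 * X 2, 0, -X 0 ^ 4] ![0, 0, 0] (1) (by norm_num) ?_ ?_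
  · intro t ht
    simp [Matrix.det_fin_three, ht]
  · intro t i
    fin_cases i <;>
      simp [pb3, subst3_add, subst3_sub, subst3_neg, subst3_mul, subst3_pow, subst3_X,
        subst3_ofNat, C_ofNat', curve, Fin.sum_univ_three, OmF4, OmF1] <;> ring

lemma deg2 : OrbitOf OmF2 ⊆ FClos 3 (OrbitOf OmH2) := by
  refine degen_core fol2 (fun t => !![1, 0, 0; 0, t, 0; 1, 0, -t ^ 4]) ![0, 0, 0] ![0, 0, 0]
    ![0, 0, 0] ![0, X 1 ^ 3 * X 2, -X 1 ^ 4] (-1) (by norm_num) ?_ ?_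
  · intro t ht
    simp [Matrix.det_fin_three, ht]
  · intro t i
    fin_cases i <;>
      simp [pb3, subst3_add, subst3_sub, subst3_neg, subst3_mul, subst3_pow, subst3_X,
        subst3_ofNat, C_ofNat', curve, Fin.sum_univ_three, OmH2, OmF2] <;> ring

lemma deg4 : OrbitOf OmF2 ⊆ FClos 3 (OrbitOf OmH4) := by
  refine degen_core fol2 (fun t => !![1, t, 0; -1, t, 0; 1, 0, 2 * t ^ 4]) ![0, 0, 0] ![-(24 * X 0 * X 1 ^ 2 * X 2), 0, 24 * X 0 ^ 2 * X 1 ^ 2]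
    ![0, 0, 0] ![0, 16 * X 1 ^ 3 * X 2, -(16 * X 1 ^ 4)] (8) (by norm_num) ?_ ?_
  · intro t ht
    simp [Matrix.det_fin_three, ht]
  · intro t i
    fin_cases i <;>
      simp [pb3, subst3_add, subst3_sub, subst3_neg, subst3_mul, subst3_pow, subst3_X,
        subst3_ofNat, C_ofNat', curve, Fin.sum_univ_three, OmH4, OmF2] <;> ring

lemma deg6 : OrbitOf OmF2 ⊆ FClos 3 (OrbitOf OmH6) := by
  refine degen_core fol2 (fun t => !![1, t, 0; 0, 2 * t, 0; 1, 0, 8 * t ^ 4]) ![0, 0, 0] ![-(96 * X 0 * X 1 ^ 2 * X 2), 0, 96 * X 0 ^ 2 * X 1 ^ 2]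
    ![192 * X 1 ^ 3 * X 2, 0, -(192 * X 0 * X 1 ^ 3)] ![0, 256 * X 1 ^ 3 * X 2, -(256 * X 1 ^ 4)] (32) (by norm_num) ?_ ?_
  · intro t ht
    simp [Matrix.det_fin_three, ht]
  · intro t i
    fin_cases i <;>
      simp [pb3, subst3_add, subst3_sub, subst3_neg, subst3_mul, subst3_pow, subst3_X,
        subst3_ofNat, C_ofNat', curve, Fin.sum_univ_three, OmH6, OmF2] <;> ring

lemma deg8 : OrbitOf OmF2 ⊆ FClos 3 (OrbitOf OmH8) := by
  refine degen_core fol2 (fun t => !![1, 0, 0; 0, t, 0; 1, 0, -4 * t ^ 4]) ![0, 0, 0] ![12 * X 0 * X 1 ^ 2 * X 2, 0, -(12 * X 0 ^ 2 * X 1 ^ 2)]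
    ![0, 0, 0] ![0, 16 * X 1 ^ 3 * X 2, -(16 * X 1 ^ 4)] (-4) (by norm_num) ?_ ?_
  · intro t ht
    simp [Matrix.det_fin_three, ht]
  · intro t i
    fin_cases i <;>
      simp [pb3, subst3_add, subst3_sub, subst3_neg, subst3_mul, subst3_pow, subst3_X,
        subst3_ofNat, C_ofNat', curve, Fin.sum_univ_three, OmH8, OmF2] <;> ring

lemma deg42 : OrbitOf OmF2 ⊆ FClos 3 (OrbitOf OmF4) := by
  refine degen_core fol2 (fun t => !![1, 0, 0; 0, t, 0; 0, t, -t ^ 4]) ![0, 0, 0] ![0, 0, 0]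
    ![-(X 1 ^ 3 * X 2), 0, X 0 * X 1 ^ 3] ![0, 0, 0] (-1) (by norm_num) ?_ ?_
  · intro t ht
    simp [Matrix.det_fin_three, ht]
  · intro t i
    fin_cases i <;>
      simp [pb3, subst3_add, subst3_sub, subst3_neg, subst3_mul, subst3_pow, subst3_X,
        subst3_ofNat, C_ofNat', curve, Fin.sum_univ_three, OmF4, OmF2] <;> ring

lemma neH1 : OrbitOf OmH1 ≠ OrbitOf OmF1 := by
  refine ne1 ![1, 0, 0] ![0, 1, 0] ![1, 1, 0] rfl rfl rfl (by simp) (by simp) (by simp) ?_ ?_ ?_ <;>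
  · intro s t u w
    simp [E, OmH1, Fin.sum_univ_three]
    try first | ring1 | (left; ring1)

lemma neH3 : OrbitOf OmH3 ≠ OrbitOf OmF1 := by
  refine ne1 ![1, 0, 0] ![0, 1, 0] ![1, 1, 0] rfl rfl rfl (by simp) (by simp) (by simp) ?_ ?_ ?_ <;>
  · intro s t u w
    simp [E, OmH3, Fin.sum_univ_three]
    try first | ring1 | (left; ring1)

lemma neH5 : OrbitOf OmH5 ≠ OrbitOf OmF1 := by
  refine ne1 ![1, 0, 0] ![0, 1, 0] ![2, 1, 0] rfl rfl rfl (by simp) (by simp) (by simp) ?_ ?_ ?_ <;>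
  · intro s t u w
    simp [E, OmH5, Fin.sum_univ_three]
    try first | ring1 | (left; ring1)

lemma neH7 : OrbitOf OmH7 ≠ OrbitOf OmF1 := by
  refine ne1 ![1, 0, 0] ![0, 1, 0] ![2, 1, 0] rfl rfl rfl (by simp) (by simp) (by simp) ?_ ?_ ?_ <;>
  · intro s t u w
    simp [E, OmH7, Fin.sum_univ_three]
    try first | ring1 | (left; ring1)

lemma neF41 : OrbitOf OmF4 ≠ OrbitOf OmF1 := by
  obtain ⟨r, hr⟩ : ∃ r : ℂ, r ^ 2 - r + 1 = 0 := by
    have h3 : s3 ^ 2 = 3 := by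
      rw [s3, ← Complex.ofReal_pow, Real.sq_sqrt (by norm_num)]
      norm_num
    refine ⟨(1 + Complex.I * s3) / 2, ?_⟩
    linear_combination (Complex.I ^ 2 / 4) * h3 + (3 / 4) * Complex.I_sq
  refine ne1 ![0, 1, 0] ![1, -1, 0] ![1, r, 0] rfl rfl rfl (by simp) (by simp) ?_ ?_ ?_ ?_
  · intro h
    simp at h
    have h' : r = -1 := by linear_combination h
    rw [h'] at hr
    norm_num at hr
  · intro s t u w
    simp [E, OmF4, Fin.sum_univ_three]
  · intro s t u w
    simp [E, OmF4, Fin.sum_univ_three]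
    ring
  · intro s t u w
    simp [E, OmF4, Fin.sum_univ_three]
    linear_combination (s * t ^ 3 * w - t ^ 4 * u) * (r + 1) * hr

lemma neH2 : OrbitOf OmH2 ≠ OrbitOf OmF2 := by
  refine ne2 1 1 (by simp) ?_ ?_ <;>
  · intro v
    simp [E, OmH2, Fin.sum_univ_three]
    try first | ring1 | (left; ring1)

lemma neH4 : OrbitOf OmH4 ≠ OrbitOf OmF2 := by
  refine ne2 1 0 (by simp) ?_ ?_ <;>
  · intro v
    simp [E, OmH4, Fin.sum_univ_three]
    try first | ring1 | (left; ring1)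

lemma neH6 : OrbitOf OmH6 ≠ OrbitOf OmF2 := by
  refine ne2 0 1 (by simp) ?_ ?_ <;>
  · intro v
    simp [E, OmH6, Fin.sum_univ_three]
    try first | ring1 | (left; ring1)

lemma neH8 : OrbitOf OmH8 ≠ OrbitOf OmF2 := by
  refine ne2 2 1 (by simp) ?_ ?_ <;>
  · intro v
    simp [E, OmH8, Fin.sum_univ_three]
    try first | ring1 | (left; ring1)

lemma neF42 : OrbitOf OmF4 ≠ OrbitOf OmF2 := by
  refine ne2 0 1 (by simp) ?_ ?_ <;>
  · intro v
    simp [E, OmF4, Fin.sum_univ_three]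
    try first | ring1 | (left; ring1)

/-- **Degenerations onto `F₁` and `F₂`.**
In `F(3)`, the foliations `H₁, H₃, H₅, H₇, F₄` all degenerate onto `F₁`, and the
foliations `H₂, H₄, H₆, H₈, F₄` all degenerate onto `F₂`. -/
theorem stmt_17 :
    Degen OmH1 OmF1 ∧ Degen OmH3 OmF1 ∧ Degen OmH5 OmF1 ∧ Degen OmH7 OmF1 ∧
    Degen OmF4 OmF1 ∧
    Degen OmH2 OmF2 ∧ Degen OmH4 OmF2 ∧ Degen OmH6 OmF2 ∧ Degen OmH8 OmF2 ∧
    Degen OmF4 OmF2 := by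
  exact ⟨⟨deg1, neH1⟩, ⟨deg3, neH3⟩, ⟨deg5, neH5⟩, ⟨deg7, neH7⟩, ⟨deg41, neF41⟩,
    ⟨deg2, neH2⟩, ⟨deg4, neH4⟩, ⟨deg6, neH6⟩, ⟨deg8, neH8⟩, ⟨deg42, neF42⟩⟩
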